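/- Let F be a Schwartz SO(3)-invariant function on ℝ³×ℝ³ and let RF(x,t) = ∫_{ℝ²} F(x,(y₁,y₂,t)) dy₁dy₂. Then the spherical transforms are intertwined: (a) for all λ>0, l∈ℕ, r∈ℝ, ∫_{ℝ³×ℝ} RF(x,t)·φ'_{λ,l,r}(x,t) dx dt = ∫_{ℝ³×ℝ³} F(x,y)·conj(φ_{λ,l,r}(x,y)) dx dy; and (b) for all ζ,r∈ℝ, ∫_{ℝ³×ℝ} RF(x,t)·φ'_{ζ,r}(x,t) dx dt = ∫_{ℝ³×ℝ³} F(x,y)·φ_{0,R}(x,y) dx dy where R = √(ζ²+r²). (This expresses 𝒢'(RF) = 𝒢F ∘ Π.) -/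

import Mathlib

open MeasureTheory Complex Matrix

noncomputable section

abbrev V3 := Fin 3 → ℝ
abbrev Mat3 := Matrix (Fin 3) (Fin 3) ℝ

instance : MeasurableSpace Mat3 := (inferInstance : MeasurableSpace (Fin 3 → Fin 3 → ℝ))

/-- The set of special orthogonal 3×3 real matrices. -/
def SO3 : Set Mat3 := {A | A * A.transpose = 1 ∧ A.det = 1}

/-- `SO(3)`-invariance of a function on `ℝ³ × ℝ³` (simultaneous action on both factors). -/
def Inv3 (F : V3 × V3 → ℂ) : Prop :=
  ∀ k ∈ SO3, ∀ x y : V3, F (k.mulVec x, k.mulVec y) = F (x, y)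

/-- `μ` is the Haar probability measure of `SO(3)`, viewed as a measure on the space of
matrices: a left-invariant Borel probability measure concentrated on `SO3`.  (On the
compact metrizable group `SO(3)` such a measure is unique.) -/
def IsHaarSO3 (μ : Measure Mat3) : Prop :=
  IsProbabilityMeasure μ ∧ μ SO3ᶜ = 0 ∧ ∀ k ∈ SO3, μ.map (fun A => k * A) = μ

/-- The Laguerre function of order 0: `𝓛_l(u) = (1/l!) e^{u/2} (d/du)^l (u^l e^{-u})`. -/
def lag (l : ℕ) (u : ℝ) : ℝ :=
  (l.factorial : ℝ)⁻¹ * Real.exp (u / 2) * deriv^[l] (fun v : ℝ => v ^ l * Real.exp (-v)) u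

/-- The regular bounded spherical functions `φ_{λ,l,r}` of `(SO(3) ⋉ N_{3,2}, SO(3))`:
`φ_{λ,l,r}(x,y) = ∫_{SO(3)} e^{-iλ(ky)₃} 𝓛_l((λ/2)((kx)₁² + (kx)₂²)) e^{-ir(kx)₃} dk`. -/
def sph (μ : Measure Mat3) (lam : ℝ) (l : ℕ) (r : ℝ) (x y : V3) : ℂ :=
  ∫ k, Complex.exp (-(Complex.I * lam * ((k.mulVec y) 2))) *
      (lag l (lam / 2 * (((k.mulVec x) 0) ^ 2 + ((k.mulVec x) 1) ^ 2)) : ℝ) *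
      Complex.exp (-(Complex.I * r * ((k.mulVec x) 2))) ∂μ

/-- The Euclidean norm on `ℝ³`. -/
def nrm3 (x : V3) : ℝ := Real.sqrt (x 0 ^ 2 + x 1 ^ 2 + x 2 ^ 2)

/-- The singular bounded spherical functions `φ_{0,R}(x,y) = sin(R|x|)/(R|x|)`,
interpreted as `1` when `R|x| = 0`. -/
def sph0 (R : ℝ) (x : V3) : ℝ :=
  if R * nrm3 x = 0 then 1 else Real.sin (R * nrm3 x) / (R * nrm3 x)

/-- The orthogonal group `O(2)` as a set of 2×2 matrices. -/
def O2 : Set (Matrix (Fin 2) (Fin 2) ℝ) := {A | A * A.transpose = 1}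

/-- The action of `A ∈ O(2)` on `ℝ³ × ℝ`:
`A·(x₁,x₂,x₃,t) = (A(x₁,x₂), (det A)x₃, (det A)t)`. -/
def KAct (A : Matrix (Fin 2) (Fin 2) ℝ) (p : (Fin 3 → ℝ) × ℝ) : (Fin 3 → ℝ) × ℝ :=
  (![A.mulVec ![p.1 0, p.1 1] 0, A.mulVec ![p.1 0, p.1 1] 1, A.det * p.1 2], A.det * p.2)

/-- `K'`-invariance of a function on `ℝ³ × ℝ`. -/
def InvK' (G : (Fin 3 → ℝ) × ℝ → ℂ) : Prop := ∀ A ∈ O2, ∀ p, G (KAct A p) = G p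

/-- The regular bounded spherical functions of `(K' ⋉ N', K')`:
`φ'_{λ,l,r}(x,t) = cos(λt + r x₃) · 𝓛_l((λ/2)(x₁² + x₂²))`. -/
def sph' (lam : ℝ) (l : ℕ) (r : ℝ) (p : (Fin 3 → ℝ) × ℝ) : ℝ :=
  Real.cos (lam * p.2 + r * p.1 2) * lag l (lam / 2 * ((p.1 0) ^ 2 + (p.1 1) ^ 2))

/-- The Bessel function of order 0: `J₀(z) = (1/π) ∫₀^π cos(z sin θ) dθ`. -/
def J0 (z : ℝ) : ℝ := (1 / Real.pi) * ∫ θ in (0:ℝ)..Real.pi, Real.cos (z * Real.sin θ)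

/-- The singular bounded spherical functions of `(K' ⋉ N', K')`:
`φ'_{ζ,r}(x,t) = J₀(ζ √(x₁² + x₂²)) · cos(r x₃)`. -/
def sphSing' (zeta r : ℝ) (p : (Fin 3 → ℝ) × ℝ) : ℝ :=
  J0 (zeta * Real.sqrt ((p.1 0) ^ 2 + (p.1 1) ^ 2)) * Real.cos (r * p.1 2)

/-- The Radon-type map: `RF(x,t) = ∫_{ℝ²} F(x, (y₁, y₂, t)) dy₁ dy₂`. -/
def RadonT (F : (Fin 3 → ℝ) × (Fin 3 → ℝ) → ℂ) (x : Fin 3 → ℝ) (t : ℝ) : ℂ :=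
  ∫ w : ℝ × ℝ, F (x, ![w.1, w.2, t])


lemma so3_mulT {k : Mat3} (hk : k ∈ SO3) : k.transpose * k = 1 :=
  mul_eq_one_comm.mp hk.1

/-- rotation as measurable equivalence -/
def rotEquiv (k : Mat3) (hk : k ∈ SO3) : V3 ≃ᵐ V3 where
  toFun := k.mulVec
  invFun := k.transpose.mulVec
  left_inv x := by simp [so3_mulT hk]
  right_inv x := by simp [hk.1]
  measurable_toFun := (Continuous.matrix_mulVec continuous_const continuous_id).measurable
  measurable_invFun := (Continuous.matrix_mulVec continuous_const continuous_id).measurable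

lemma rot_mp (k : Mat3) (hk : k ∈ SO3) :
    MeasurePreserving (rotEquiv k hk) volume volume := by
  refine ⟨(rotEquiv k hk).measurable, ?_⟩
  have h := Real.map_matrix_volume_pi_eq_smul_volume_pi (M := k) (by rw [hk.2]; norm_num)
  rw [hk.2] at h
  have h' : Measure.map (⇑(toLin' k)) volume = volume := by simpa using h
  exact h'

lemma rot_inv (F : V3 × V3 → ℂ) (hF : Inv3 F) (E : V3 → V3 → ℂ) (k : Mat3) (hk : k ∈ SO3) :
    ∫ p : V3 × V3, F p * E (k.mulVec p.1) (k.mulVec p.2) = ∫ p : V3 × V3, F p * E p.1 p.2 := by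
  have h := ((rot_mp k hk).prod (rot_mp k hk)).integral_comp
    ((rotEquiv k hk).prodCongr (rotEquiv k hk)).measurableEmbedding (fun p => F p * E p.1 p.2)
  refine Eq.trans ?_ h
  refine integral_congr_ae (Filter.Eventually.of_forall fun p => ?_)
  change _ = F (k.mulVec p.1, k.mulVec p.2) * E (k.mulVec p.1) (k.mulVec p.2)
  rw [hF k hk p.1 p.2]

/-- coordinates on ℝ³ -/
def e3 : (ℝ × ℝ) × ℝ ≃ᵐ V3 where
  toFun q := ![q.1.1, q.1.2, q.2]
  invFun x := ((x 0, x 1), x 2)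
  left_inv q := by simp
  right_inv x := by ext i; fin_cases i <;> rfl
  measurable_toFun := by
    apply Continuous.measurable
    refine continuous_pi fun i => ?_
    fin_cases i <;> simp <;> fun_prop
  measurable_invFun := by
    change Measurable (fun x : V3 => ((x 0, x 1), x 2))
    fun_prop

lemma e3_mp : MeasurePreserving e3 volume volume := by
  have h1 := volume_preserving_piFinSuccAbove (fun _ : Fin 3 => ℝ) 2
  have h2 := (MeasurePreserving.id (volume : Measure ℝ)).prod (volume_preserving_finTwoArrow ℝ)
  have h3 := (Measure.measurePreserving_swap (μ := (volume : Measure ℝ)) (ν := (volume : Measure (ℝ × ℝ)))).comp (h2.comp h1)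
  have h4 : MeasurePreserving e3.symm volume volume := by
    have : ⇑e3.symm = Prod.swap ∘ Prod.map id ⇑MeasurableEquiv.finTwoArrow ∘
        ⇑(MeasurableEquiv.piFinSuccAbove (fun _ : Fin 3 => ℝ) 2) := by
      ext x <;> rfl
    rw [this]
    exact h3
  exact h4.symm

lemma schwartz_int (F : SchwartzMap (V3 × V3) ℂ) : Integrable (fun p => F p) := by
  have : (volume : Measure (V3 × V3)).IsAddHaarMeasure :=
    Measure.prod.instIsAddHaarMeasure (volume : Measure V3) (volume : Measure V3)
  exact F.integrable

lemma schwartz_bdd_integrable (F : SchwartzMap (V3 × V3) ℂ) (E : V3 × V3 → ℂ)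
    (hE : Continuous E) (C : ℝ) (hC : ∀ p, ‖E p‖ ≤ C) : Integrable (fun p => F p * E p) := by
  exact (schwartz_int F).mul_bdd (c := C) hE.aestronglyMeasurable (Filter.Eventually.of_forall hC)

lemma radon_fubini (F : SchwartzMap (V3 × V3) ℂ) (E : V3 × ℝ → ℂ)
    (hE : Continuous E) (C : ℝ) (hC : ∀ p, ‖E p‖ ≤ C) :
    ∫ p : V3 × ℝ, RadonT ⇑F p.1 p.2 * E p = ∫ q : V3 × V3, F q * E (q.1, q.2 2) := by
  have hint : Integrable (fun q : V3 × V3 => F q * E (q.1, q.2 2)) :=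
    schwartz_bdd_integrable F (fun q => E (q.1, q.2 2)) (by fun_prop) C (fun p => hC _)
  have m1 : MeasurePreserving (Prod.map id e3 : V3 × ((ℝ × ℝ) × ℝ) → V3 × V3) volume volume :=
    (MeasurePreserving.id _).prod e3_mp
  have m2 : MeasurePreserving (Prod.map id Prod.swap : V3 × (ℝ × (ℝ × ℝ)) → V3 × ((ℝ × ℝ) × ℝ)) volume volume :=
    (MeasurePreserving.id _).prod Measure.measurePreserving_swap
  have m3 := volume_preserving_prodAssoc (α₁ := V3) (β₁ := ℝ) (γ₁ := ℝ × ℝ)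
  have m := m1.comp (m2.comp m3)
  have emb : MeasurableEmbedding (Prod.map id e3 ∘ Prod.map id Prod.swap ∘ (MeasurableEquiv.prodAssoc : (V3 × ℝ) × (ℝ × ℝ) ≃ᵐ _)) := by
    refine MeasurableEmbedding.comp ?_ (MeasurableEmbedding.comp ?_ MeasurableEquiv.prodAssoc.measurableEmbedding)
    · exact ((MeasurableEquiv.refl V3).prodCongr e3).measurableEmbedding
    · exact ((MeasurableEquiv.refl V3).prodCongr MeasurableEquiv.prodComm).measurableEmbedding
  rw [← m.integral_comp emb]
  have hint' := (m.integrable_comp_emb emb).mpr hint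
  refine Eq.trans ?_ (integral_prod _ hint').symm
  refine integral_congr_ae (Filter.Eventually.of_forall fun p => ?_)
  simp only [RadonT]
  rw [← integral_mul_const]
  rfl

lemma iter_deriv (P : Polynomial ℝ) (n : ℕ) : ∃ Q : Polynomial ℝ,
    deriv^[n] (fun v : ℝ => P.eval v * Real.exp (-v)) = fun v => Q.eval v * Real.exp (-v) := by
  induction n with
  | zero => exact ⟨P, rfl⟩
  | succ n ih =>
    obtain ⟨Q, hQ⟩ := ih
    refine ⟨Q.derivative - Q, ?_⟩
    rw [Function.iterate_succ_apply', hQ]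
    ext v
    have h := (Q.hasDerivAt v).mul ((hasDerivAt_neg v).exp)
    rw [show (fun v => Q.eval v * Real.exp (-v)) = (fun x => Q.eval x) * (fun x => Real.exp (-x)) from rfl, h.deriv]
    simp
    ring

lemma lag_form (l : ℕ) : ∃ Q : Polynomial ℝ, ∀ u, lag l u = Q.eval u * Real.exp (-(u/2)) := by
  obtain ⟨Q, hQ⟩ := iter_deriv (Polynomial.X ^ l) l
  refine ⟨Polynomial.C ((l.factorial : ℝ)⁻¹) * Q, fun u => ?_⟩
  simp only [Polynomial.eval_pow, Polynomial.eval_X] at hQ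
  rw [lag, hQ]
  have : Real.exp (-u) = Real.exp (-(u/2)) * Real.exp (-(u/2)) := by
    rw [← Real.exp_add]; ring_nf
  have h2 : Real.exp (u/2) * Real.exp (-(u/2)) = 1 := by
    rw [← Real.exp_add]; simp
  simp only [this, Polynomial.eval_mul, Polynomial.eval_C]
  linear_combination ((l.factorial : ℝ)⁻¹ * Q.eval u * Real.exp (-(u/2))) * h2

lemma lag_cont (l : ℕ) : Continuous (lag l) := by
  obtain ⟨Q, hQ⟩ := lag_form l
  rw [show lag l = _ from funext hQ]
  have := Q.continuous
  fun_prop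

lemma lag_bdd (l : ℕ) : ∃ C, ∀ u, 0 ≤ u → |lag l u| ≤ C := by
  obtain ⟨Q, hQ⟩ := lag_form l
  have h1 := (Q.comp (Polynomial.C 2 * Polynomial.X)).tendsto_div_exp_atTop
  have h2 : Filter.Tendsto (fun u : ℝ => lag l u) Filter.atTop (nhds 0) := by
    have := h1.comp (Filter.tendsto_id.atTop_div_const (show (0:ℝ) < 2 by norm_num))
    refine this.congr fun u => ?_
    simp [hQ, Real.exp_neg, div_eq_mul_inv]
    congr 1; ring
  have h3 := h2.abs.eventually (gt_mem_nhds (show |(0:ℝ)| < 1 by simp))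
  obtain ⟨a, ha⟩ := Filter.eventually_atTop.mp h3
  obtain ⟨C, hC⟩ := (isCompact_Icc (a := (0:ℝ)) (b := a)).exists_bound_of_continuousOn (lag_cont l).continuousOn
  refine ⟨max C 1, fun u hu => ?_⟩
  rcases le_total u a with h | h
  · exact le_max_of_le_left (by simpa using hC u ⟨hu, h⟩)
  · exact le_max_of_le_right (ha u h).le

/-- conjugated integrand -/
def Ea (lam : ℝ) (l : ℕ) (r : ℝ) (x y : V3) : ℂ :=
  Complex.exp (((lam * y 2 + r * x 2 : ℝ) : ℂ) * Complex.I) *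
    ((lag l (lam / 2 * (x 0 ^ 2 + x 1 ^ 2)) : ℝ) : ℂ)

lemma Ea_cont (lam : ℝ) (l : ℕ) (r : ℝ) : Continuous (fun p : V3 × V3 => Ea lam l r p.1 p.2) := by
  have := lag_cont l
  unfold Ea
  fun_prop

lemma Ea_bdd (lam : ℝ) (hl : 0 < lam) (l : ℕ) (r : ℝ) : ∃ C, ∀ x y, ‖Ea lam l r x y‖ ≤ C := by
  obtain ⟨C, hC⟩ := lag_bdd l
  refine ⟨C, fun x y => ?_⟩
  rw [Ea, norm_mul, Complex.norm_exp_ofReal_mul_I, one_mul, Complex.norm_real]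
  exact hC _ (by positivity)

lemma sph_conj (μ : Measure Mat3) (lam : ℝ) (l : ℕ) (r : ℝ) (x y : V3) :
    (starRingEnd ℂ) (sph μ lam l r x y) = ∫ k, Ea lam l r (k.mulVec x) (k.mulVec y) ∂μ := by
  rw [sph, ← integral_conj]
  refine integral_congr_ae (Filter.Eventually.of_forall fun k => ?_)
  simp only [Ea, map_mul, ← Complex.exp_conj, map_neg, Complex.conj_I, Complex.conj_ofReal]
  rw [mul_right_comm, ← Complex.exp_add]
  congr 2
  push_cast
  ring

lemma sph_int (μ : Measure Mat3) (hμ : IsHaarSO3 μ)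
    (F : SchwartzMap (V3 × V3) ℂ) (hF : Inv3 ⇑F) (lam : ℝ) (hl : 0 < lam) (l : ℕ) (r : ℝ) :
    ∫ p : V3 × V3, F p * (starRingEnd ℂ) (sph μ lam l r p.1 p.2) =
      ∫ p : V3 × V3, F p * Ea lam l r p.1 p.2 := by
  obtain ⟨hp, h0, -⟩ := hμ
  obtain ⟨C, hC⟩ := Ea_bdd lam hl l r
  simp_rw [sph_conj, ← integral_const_mul]
  rw [integral_integral_swap]
  · have hae : ∀ᵐ k ∂μ, k ∈ SO3 := by
      rw [ae_iff]; exact h0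
    have : ∀ᵐ k ∂μ, (∫ p : V3 × V3, F p * Ea lam l r (k.mulVec p.1) (k.mulVec p.2)) =
        ∫ p : V3 × V3, F p * Ea lam l r p.1 p.2 := by
      filter_upwards [hae] with k hk
      exact rot_inv F hF (Ea lam l r) k hk
    rw [integral_congr_ae this]
    simp
  · have h1 : Integrable (fun q : (V3 × V3) × Mat3 => F q.1 * (1:ℂ)) (volume.prod μ) :=
      (schwartz_int F).mul_prod (integrable_const (1:ℂ))
    have hme : ∀ i j, Measurable (fun k : Mat3 => k i j) := fun i j =>
      (measurable_pi_apply j).comp (measurable_pi_apply (X := fun _ : Fin 3 => Fin 3 → ℝ) i)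
    have hm : ∀ v : (V3 × V3) × Mat3 → V3, Measurable v →
        Measurable (fun q : (V3 × V3) × Mat3 => q.2.mulVec (v q)) := by
      intro v hv
      refine measurable_pi_lambda _ fun i => ?_
      simp only [Matrix.mulVec, dotProduct]
      refine Finset.measurable_sum _ fun j _ => ?_
      exact ((hme i j).comp measurable_snd).mul ((measurable_pi_apply j).comp hv)
    have h2 : Measurable (fun q : (V3 × V3) × Mat3 =>
        Ea lam l r (q.2.mulVec q.1.1) (q.2.mulVec q.1.2)) :=
      (Ea_cont lam l r).measurable.comp (f := fun q : (V3 × V3) × Mat3 => (q.2.mulVec q.1.1, q.2.mulVec q.1.2))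
        ((hm (fun q => q.1.1) (measurable_fst.comp measurable_fst)).prodMk (hm (fun q => q.1.2) (measurable_snd.comp measurable_fst)))
    have h3 := h1.mul_bdd (c := C) h2.aestronglyMeasurable (Filter.Eventually.of_forall fun q => hC _ _)
    refine h3.congr (Filter.Eventually.of_forall fun q => ?_)
    simp [Function.uncurry]

lemma part_a (μ : Measure Mat3) (hμ : IsHaarSO3 μ)
    (F : SchwartzMap (V3 × V3) ℂ) (hF : Inv3 ⇑F) (lam : ℝ) (hl : 0 < lam) (l : ℕ) (r : ℝ) :
      ∫ p : (Fin 3 → ℝ) × ℝ, RadonT ⇑F p.1 p.2 * (sph' lam l r p : ℂ)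
        = ∫ p : V3 × V3, F p * (starRingEnd ℂ) (sph μ lam l r p.1 p.2) := by
  rw [sph_int μ hμ F hF lam hl l r]
  obtain ⟨C, hC⟩ := lag_bdd l
  rw [radon_fubini F (fun p => (sph' lam l r p : ℂ)) ?_ C ?_]
  · have hk : (!![1,0,0;0,-1,0;0,0,-1] : Mat3) ∈ SO3 := by
      constructor
      · ext i j; fin_cases i <;> fin_cases j <;> simp [Matrix.mul_apply, Fin.sum_univ_three]
      · simp [Matrix.det_fin_three]
    have h1 := rot_inv F hF (Ea lam l r) _ hk
    obtain ⟨D, hD⟩ := Ea_bdd lam hl l r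
    have i1 := schwartz_bdd_integrable F _ (Ea_cont lam l r) D (fun p => hD _ _)
    have i2 := schwartz_bdd_integrable F
      (fun p : V3 × V3 => Ea lam l r (!![1,0,0;0,-1,0;0,0,-1] *ᵥ p.1) (!![1,0,0;0,-1,0;0,0,-1] *ᵥ p.2))
      ((Ea_cont lam l r).comp (by fun_prop : Continuous (fun p : V3 × V3 =>
        (!![1,0,0;0,-1,0;0,0,-1] *ᵥ p.1, !![1,0,0;0,-1,0;0,0,-1] *ᵥ p.2)))) D (fun p => hD _ _)
    have h2 := integral_add i1 i2
    rw [h1] at h2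
    have h3 : (∫ p : V3 × V3, F p * Ea lam l r p.1 p.2) =
      (1/2 : ℂ) * ((∫ p : V3 × V3, F p * Ea lam l r p.1 p.2) + (∫ p : V3 × V3, F p * Ea lam l r p.1 p.2)) := by ring
    rw [h3, ← h2, ← integral_const_mul]
    refine integral_congr_ae (Filter.Eventually.of_forall fun p => ?_)
    simp only [Ea, sph', Matrix.mulVec, dotProduct, Fin.sum_univ_three]
    simp only [Matrix.of_apply, Matrix.cons_val', Matrix.cons_val, Complex.ofReal_mul, Complex.ofReal_cos]
    rw [Complex.cos]
    have e1 : ∀ a : ℝ, ((0 * a : ℝ)) = 0 := fun a => zero_mul a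
    simp only [zero_mul, add_zero, zero_add, one_mul, neg_one_mul, neg_sq, mul_neg]
    have : (((-(lam * p.2 2) + -(r * p.1 2) : ℝ)) : ℂ) * I = -(((lam * p.2 2 + r * p.1 2 : ℝ)) : ℂ) * I := by
      push_cast; ring
    rw [this]
    ring
  · have := lag_cont l
    unfold sph'
    fun_prop
  · intro p
    rw [Complex.norm_real, sph', Real.norm_eq_abs, abs_mul]
    calc _ ≤ 1 * C := mul_le_mul (Real.abs_cos_le_one _) (hC _ (by positivity)) (abs_nonneg _) zero_le_one
      _ = C := one_mul C

lemma J0_cont : Continuous J0 := by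
  unfold J0
  refine continuous_const.mul ?_
  apply intervalIntegral.continuous_parametric_intervalIntegral_of_continuous'
  simp only [Function.uncurry_def]
  fun_prop

lemma J0_bdd (z : ℝ) : |J0 z| ≤ 1 := by
  have h : ‖∫ θ in (0:ℝ)..Real.pi, Real.cos (z * Real.sin θ)‖ ≤ 1 * |Real.pi - 0| :=
    intervalIntegral.norm_integral_le_of_norm_le_const fun θ _ => Real.abs_cos_le_one _
  rw [J0, abs_mul]
  rw [sub_zero, one_mul, Real.norm_eq_abs] at h
  rw [abs_of_pos Real.pi_pos] at h
  rw [abs_of_pos (by positivity)]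
  calc _ ≤ 1 / Real.pi * Real.pi := by gcongr
    _ = 1 := by field_simp

def rotZ (θ : ℝ) : Mat3 := !![Real.cos θ, -Real.sin θ, 0; Real.sin θ, Real.cos θ, 0; 0, 0, 1]
def rotX (θ : ℝ) : Mat3 := !![1, 0, 0; 0, Real.cos θ, -Real.sin θ; 0, Real.sin θ, Real.cos θ]

lemma rotZ_mem (θ : ℝ) : rotZ θ ∈ SO3 := by
  have h := Real.sin_sq_add_cos_sq θ
  constructor
  · ext i j
    fin_cases i <;> fin_cases j <;> simp [rotZ, Matrix.mul_apply, Fin.sum_univ_three] <;> nlinarith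
  · simp [rotZ, Matrix.det_fin_three]; nlinarith

lemma rotX_mem (θ : ℝ) : rotX θ ∈ SO3 := by
  have h := Real.sin_sq_add_cos_sq θ
  constructor
  · ext i j
    fin_cases i <;> fin_cases j <;> simp [rotX, Matrix.mul_apply, Fin.sum_univ_three] <;> nlinarith
  · simp [rotX, Matrix.det_fin_three]; nlinarith

lemma rotZ_apply (θ : ℝ) (x : V3) : rotZ θ *ᵥ x =
    ![Real.cos θ * x 0 - Real.sin θ * x 1, Real.sin θ * x 0 + Real.cos θ * x 1, x 2] := by
  ext i; fin_cases i <;> simp [rotZ, Matrix.mulVec, dotProduct, Fin.sum_univ_three] <;> ring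

lemma rotX_apply (θ : ℝ) (x : V3) : rotX θ *ᵥ x =
    ![x 0, Real.cos θ * x 1 - Real.sin θ * x 2, Real.sin θ * x 1 + Real.cos θ * x 2] := by
  ext i; fin_cases i <;> simp [rotX, Matrix.mulVec, dotProduct, Fin.sum_univ_three] <;> ring

lemma exists_angle (a b : ℝ) : ∃ β : ℝ, a = Real.sqrt (a ^ 2 + b ^ 2) * Real.cos β ∧
    b = Real.sqrt (a ^ 2 + b ^ 2) * Real.sin β := by
  have hn : ‖(⟨a, b⟩ : ℂ)‖ = Real.sqrt (a ^ 2 + b ^ 2) := by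
    rw [Complex.norm_def, Complex.normSq_mk]; ring_nf
  refine ⟨Complex.arg ⟨a, b⟩, ?_, ?_⟩
  · rw [← hn, Complex.norm_mul_cos_arg]
  · rw [← hn, Complex.norm_mul_sin_arg]

lemma bessel_avg (ζ a b : ℝ) :
    ∫ φ in (0:ℝ)..Real.pi, Real.cos (ζ * (Real.sin φ * a + Real.cos φ * b)) =
      Real.pi * J0 (ζ * Real.sqrt (a ^ 2 + b ^ 2)) := by
  obtain ⟨β, ha, hb⟩ := exists_angle a b
  set ρ := Real.sqrt (a ^ 2 + b ^ 2)
  have e : ∀ φ, Real.cos (ζ * (Real.sin φ * a + Real.cos φ * b)) =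
      (fun t => Real.cos (ζ * ρ * Real.sin t)) (φ + β) := by
    intro φ
    simp only [Real.sin_add]
    conv_lhs => rw [ha, hb]
    congr 1; ring
  simp_rw [e]
  rw [intervalIntegral.integral_comp_add_right (fun t => Real.cos (ζ * ρ * Real.sin t))]
  have per : Function.Periodic (fun t => Real.cos (ζ * ρ * Real.sin t)) Real.pi := by
    intro t
    simp [Real.sin_add_pi]
  have h := per.intervalIntegral_add_eq β 0
  rw [zero_add] at h ⊢
  rw [add_comm Real.pi β, h, J0]
  field_simp

lemma b_step1 (F : SchwartzMap (V3 × V3) ℂ) (hF : Inv3 ⇑F) (ζ r : ℝ) :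
    ∫ q : V3 × V3, F q * ((J0 (ζ * Real.sqrt (q.1 0 ^ 2 + q.1 1 ^ 2)) * Real.cos (r * q.1 2) : ℝ) : ℂ)
     = ∫ q : V3 × V3, F q * ((Real.cos (ζ * q.1 1) * Real.cos (r * q.1 2) : ℝ) : ℂ) := by
  set A := ∫ q : V3 × V3, F q * ((Real.cos (ζ * q.1 1) * Real.cos (r * q.1 2) : ℝ) : ℂ) with hA
  have hφ : ∀ φ : ℝ, ∫ q : V3 × V3, F q * ((Real.cos (ζ * (Real.sin φ * q.1 0 + Real.cos φ * q.1 1)) * Real.cos (r * q.1 2) : ℝ) : ℂ) = A := by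
    intro φ
    have := rot_inv F hF (fun x _ => ((Real.cos (ζ * x 1) * Real.cos (r * x 2) : ℝ) : ℂ)) _ (rotZ_mem φ)
    rw [hA]
    simpa [rotZ_apply] using this
  have hsw : ∫ φ in Set.Ioc 0 Real.pi, ∫ q : V3 × V3, F q * ((Real.cos (ζ * (Real.sin φ * q.1 0 + Real.cos φ * q.1 1)) * Real.cos (r * q.1 2) : ℝ) : ℂ) =
      ∫ q : V3 × V3, ∫ φ in Set.Ioc 0 Real.pi, F q * ((Real.cos (ζ * (Real.sin φ * q.1 0 + Real.cos φ * q.1 1)) * Real.cos (r * q.1 2) : ℝ) : ℂ) := by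
    rw [integral_integral_swap]
    have h1 : Integrable (fun q : ℝ × (V3 × V3) => (1:ℂ) * F q.2) ((volume.restrict (Set.Ioc 0 Real.pi)).prod volume) :=
      Integrable.mul_prod (integrable_const (1:ℂ)) (schwartz_int F)
    have h2 : Continuous (fun q : ℝ × (V3 × V3) => ((Real.cos (ζ * (Real.sin q.1 * q.2.1 0 + Real.cos q.1 * q.2.1 1)) * Real.cos (r * q.2.1 2) : ℝ) : ℂ)) := by
      fun_prop
    have h3 := h1.mul_bdd (c := 1) h2.aestronglyMeasurable (Filter.Eventually.of_forall fun q => by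
      rw [Complex.norm_real, norm_mul]
      exact mul_le_one₀ (Real.abs_cos_le_one _) (norm_nonneg _) (Real.abs_cos_le_one _))
    refine h3.congr (Filter.Eventually.of_forall fun q => ?_)
    simp [Function.uncurry]
  simp_rw [hφ] at hsw
  have hin : ∀ q : V3 × V3, ∫ φ in Set.Ioc 0 Real.pi, F q * ((Real.cos (ζ * (Real.sin φ * q.1 0 + Real.cos φ * q.1 1)) * Real.cos (r * q.1 2) : ℝ) : ℂ)
      = (Real.pi : ℂ) * (F q * ((J0 (ζ * Real.sqrt (q.1 0 ^ 2 + q.1 1 ^ 2)) * Real.cos (r * q.1 2) : ℝ) : ℂ)) := by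
    intro q
    rw [integral_const_mul, integral_complex_ofReal, integral_mul_const, ← intervalIntegral.integral_of_le Real.pi_pos.le, bessel_avg]
    push_cast
    ring
  simp_rw [hin] at hsw
  rw [integral_const_mul] at hsw
  simp [Real.pi_pos.le] at hsw
  push_cast
  exact hsw.symm

lemma b_step2 (F : SchwartzMap (V3 × V3) ℂ) (hF : Inv3 ⇑F) (ζ r : ℝ) :
    ∫ q : V3 × V3, F q * ((Real.cos (ζ * q.1 1) * Real.cos (r * q.1 2) : ℝ) : ℂ)
     = ∫ q : V3 × V3, F q * ((Real.cos (Real.sqrt (ζ ^ 2 + r ^ 2) * q.1 2) : ℝ) : ℂ) := by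
  obtain ⟨β, hr, hz⟩ := exists_angle r ζ
  rw [add_comm (ζ ^ 2)]
  set R := Real.sqrt (r ^ 2 + ζ ^ 2)
  have h1 := rot_inv F hF (fun x _ => ((Real.cos (R * x 2) : ℝ) : ℂ)) _ (rotX_mem β)
  have h2 := rot_inv F hF (fun x _ => ((Real.cos (ζ * x 1 + r * x 2) : ℝ) : ℂ)) _ (rotZ_mem Real.pi)
  have h1' : ∫ q : V3 × V3, F q * ((Real.cos (ζ * q.1 1 + r * q.1 2) : ℝ) : ℂ) = ∫ q : V3 × V3, F q * ((Real.cos (R * q.1 2) : ℝ) : ℂ) := by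
    rw [← h1]
    refine integral_congr_ae (Filter.Eventually.of_forall fun q => ?_)
    simp only [rotX_apply]
    simp only [Matrix.cons_val]
    have : ζ * q.1 1 + r * q.1 2 = R * (Real.sin β * q.1 1 + Real.cos β * q.1 2) := by
      linear_combination q.1 1 * hz + q.1 2 * hr
    rw [this]
  have i : ∀ a b : ℝ, Integrable (fun q : V3 × V3 => F q * ((Real.cos (a * q.1 1 + b * q.1 2) : ℝ) : ℂ)) := fun a b =>
    schwartz_bdd_integrable F _ (by fun_prop) 1 (fun p => by
      rw [Complex.norm_real]; exact Real.abs_cos_le_one _)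
  have h3 : ∫ q : V3 × V3, F q * ((Real.cos (-ζ * q.1 1 + r * q.1 2) : ℝ) : ℂ) =
      ∫ q : V3 × V3, F q * ((Real.cos (ζ * q.1 1 + r * q.1 2) : ℝ) : ℂ) := by
    rw [← h2]
    refine integral_congr_ae (Filter.Eventually.of_forall fun q => ?_)
    simp [rotZ_apply]
  have h4 := integral_add (i ζ r) (i (-ζ) r)
  rw [h3, h1'] at h4
  have h5 : ∀ X : ℂ, X = (1/2 : ℂ) * (X + X) := fun X => by ring
  rw [h5 (∫ q : V3 × V3, F q * ((Real.cos (R * q.1 2) : ℝ) : ℂ)), ← h4, ← integral_const_mul]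
  refine integral_congr_ae (Filter.Eventually.of_forall fun q => ?_)
  simp only [Real.cos_add, neg_mul, Real.cos_neg, Real.sin_neg]
  push_cast
  ring

lemma radial_slice (h : ℝ → ℂ) (z : ℝ) :
    ∫ w : ℝ × ℝ, h (Real.sqrt (w.1 ^ 2 + w.2 ^ 2 + z ^ 2)) =
      2 * Real.pi * ∫ u in Set.Ioi |z|, (u : ℂ) * h u := by
  rw [← integral_comp_polarCoord_symm]
  have e : ∀ p : ℝ × ℝ, p.1 • h (Real.sqrt ((polarCoord.symm p).1 ^ 2 + (polarCoord.symm p).2 ^ 2 + z ^ 2)) =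
      ((p.1 : ℂ) * h (Real.sqrt (p.1 ^ 2 + z ^ 2))) * (fun _ : ℝ => (1 : ℂ)) p.2 := by
    intro p
    simp only [polarCoord_symm_apply, mul_one, Complex.real_smul]
    congr 4
    have := Real.sin_sq_add_cos_sq p.2
    linear_combination p.1 ^ 2 * this
  simp_rw [e]
  rw [polarCoord_target, Measure.volume_eq_prod]
  rw [setIntegral_prod_mul (fun s : ℝ => (s : ℂ) * h (Real.sqrt (s ^ 2 + z ^ 2))) (fun _ : ℝ => (1 : ℂ))]
  have himg : (fun s : ℝ => Real.sqrt (s ^ 2 + z ^ 2)) '' Set.Ioi 0 = Set.Ioi |z| := by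
    ext u
    simp only [Set.mem_image, Set.mem_Ioi]
    constructor
    · rintro ⟨s, hs, rfl⟩
      rw [← Real.sqrt_sq_eq_abs]
      exact Real.sqrt_lt_sqrt (sq_nonneg _) (by nlinarith)
    · intro hu
      have hu0 : 0 < u := lt_of_le_of_lt (abs_nonneg z) hu
      have : z ^ 2 < u ^ 2 := by
        rw [← sq_abs z]; nlinarith [abs_nonneg z]
      refine ⟨Real.sqrt (u ^ 2 - z ^ 2), Real.sqrt_pos.mpr (by linarith), ?_⟩
      rw [Real.sq_sqrt (by linarith), sub_add_cancel, Real.sqrt_sq hu0.le]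
  have hcv := integral_image_eq_integral_abs_deriv_smul (s := Set.Ioi (0:ℝ))
    (f := fun s : ℝ => Real.sqrt (s ^ 2 + z ^ 2)) (f' := fun s => s / Real.sqrt (s ^ 2 + z ^ 2))
    measurableSet_Ioi ?_ ?_ (fun u : ℝ => (u : ℂ) * h u)
  · rw [himg] at hcv
    rw [hcv]
    have h1 : ∫ y in Set.Ioo (-Real.pi) Real.pi, (1:ℂ) = 2 * Real.pi := by
      simp [Real.pi_pos.le]; ring_nf
    rw [h1, mul_comm]
    congr 1
    refine setIntegral_congr_fun measurableSet_Ioi fun s hs => ?_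
    have hs' : (0:ℝ) < s := hs
    have hpos : 0 < Real.sqrt (s ^ 2 + z ^ 2) := Real.sqrt_pos.mpr (by positivity)
    have hne : ((Real.sqrt (s ^ 2 + z ^ 2) : ℝ) : ℂ) ≠ 0 := by exact_mod_cast hpos.ne'
    rw [abs_of_pos (by positivity), Complex.real_smul]
    push_cast
    field_simp
  · intro s hs
    have hs' : (0:ℝ) < s := hs
    have h0 : s ^ 2 + z ^ 2 ≠ 0 := by positivity
    have hd : HasDerivAt (fun s : ℝ => s ^ 2 + z ^ 2) (2 * s) s := by
      simpa using (hasDerivAt_pow 2 s).add_const (z ^ 2)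
    have := hd.sqrt h0
    rw [mul_div_mul_left _ _ (by norm_num)] at this
    exact this.hasDerivWithinAt
  · intro s hs t ht hst
    have hs' : (0:ℝ) < s := hs
    have ht' : (0:ℝ) < t := ht
    have := (Real.sqrt_inj (by positivity) (by positivity)).mp hst
    nlinarith

lemma cyl (h : ℝ → ℂ) (hm : Measurable h) (C : ℝ) (hC : ∀ u, ‖h u‖ ≤ C * ((1 + u ^ 2) ^ 3)⁻¹)
    (hint : Integrable (fun x : V3 => h (nrm3 x)))
    (e : ℝ → ℂ) (he : Continuous e) (he1 : ∀ z, ‖e z‖ ≤ 1) :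
    ∫ x : V3, h (nrm3 x) * e (x 2) =
      2 * Real.pi * ∫ u : ℝ, (∫ z in Set.Ioo (-u) u, e z) * (u * h u) := by
  have hint1 : Integrable (fun x : V3 => h (nrm3 x) * e (x 2)) :=
    hint.mul_bdd (c := 1) (by fun_prop : Continuous fun x : V3 => e (x 2)).aestronglyMeasurable
      (Filter.Eventually.of_forall fun x => he1 _)
  rw [← e3_mp.integral_comp e3.measurableEmbedding]
  have hint2 := (e3_mp.integrable_comp_emb e3.measurableEmbedding).mpr hint1
  refine Eq.trans (integral_prod_symm _ hint2) ?_
  have h1 : ∀ z : ℝ, ∫ w : ℝ × ℝ, ((fun x : V3 => h (nrm3 x) * e (x 2)) ∘ ⇑e3) (w, z) =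
      2 * Real.pi * ∫ u : ℝ, (Set.Ioo (-u) u).indicator e z * (u * h u) := by
    intro z
    have : ∀ w : ℝ × ℝ, ((fun x : V3 => h (nrm3 x) * e (x 2)) ∘ ⇑e3) (w, z) =
      h (Real.sqrt (w.1 ^ 2 + w.2 ^ 2 + z ^ 2)) * e z := fun w => rfl
    simp_rw [this]
    rw [integral_mul_const, radial_slice, mul_assoc, ← integral_mul_const, ← integral_indicator measurableSet_Ioi]
    congr 2
    ext u
    simp only [Set.indicator, Set.mem_Ioi, Set.mem_Ioo, abs_lt]
    split_ifs
    · ring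
    · simp
  refine Eq.trans (integral_congr_ae (Filter.Eventually.of_forall h1)) ?_
  rw [integral_const_mul, integral_integral_swap]
  · congr 2
    ext u
    rw [integral_mul_const, integral_indicator measurableSet_Ioo]
  · have hb : Integrable (fun q : ℝ × ℝ => (1 + q.1 ^ 2)⁻¹ * (C * (1 + q.2 ^ 2)⁻¹)) (volume.prod volume) :=
      integrable_inv_one_add_sq.mul_prod (integrable_inv_one_add_sq.const_mul C)
    refine hb.mono' ?_ (Filter.Eventually.of_forall fun q => ?_)
    · apply Measurable.aestronglyMeasurable
      have hset : MeasurableSet {q : ℝ × ℝ | -q.2 < q.1 ∧ q.1 < q.2} :=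
        (measurableSet_lt measurable_snd.neg measurable_fst).inter (measurableSet_lt measurable_fst measurable_snd)
      have : Function.uncurry (fun (z u : ℝ) => (Set.Ioo (-u) u).indicator e z * (u * h u)) =
        fun q => {q : ℝ × ℝ | -q.2 < q.1 ∧ q.1 < q.2}.indicator (fun q => e q.1) q * (q.2 * h q.2) := by
        ext ⟨z, u⟩
        simp [Set.indicator, Function.uncurry]
      rw [this]
      refine Measurable.mul (Measurable.indicator (by fun_prop) hset) (by fun_prop)
    · obtain ⟨z, u⟩ := q
      have hC0 : 0 ≤ C := by
        have := (norm_nonneg _).trans (hC 0)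
        simpa using this
      simp only [Function.uncurry, Set.indicator, Set.mem_Ioo]
      split_ifs with hzu
      · have hzz : z ^ 2 ≤ u ^ 2 := by nlinarith
        rw [norm_mul, norm_mul, Complex.norm_real, Real.norm_eq_abs]
        have hu : |u| ≤ 1 + u ^ 2 := by rw [← sq_abs u]; nlinarith [sq_nonneg (|u| - 1), abs_nonneg u]
        calc ‖e z‖ * (|u| * ‖h u‖) ≤ 1 * ((1 + u ^ 2) * (C * ((1 + u ^ 2) ^ 3)⁻¹)) := by
              gcongr
              · exact he1 z
              · exact hC u
          _ = (1 + u ^ 2)⁻¹ * (C * (1 + u ^ 2)⁻¹) := by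
              have : 1 + u ^ 2 ≠ 0 := by positivity
              field_simp
          _ ≤ (1 + z ^ 2)⁻¹ * (C * (1 + u ^ 2)⁻¹) := by gcongr
      · simp; positivity

lemma int_cos (R u : ℝ) (hu : 0 ≤ u) :
    ∫ z in Set.Ioo (-u) u, ((Real.cos (R * z) : ℝ) : ℂ) = ((2 * u * Real.sinc (R * u) : ℝ) : ℂ) := by
  rw [integral_complex_ofReal, ← integral_Ioc_eq_integral_Ioo, ← intervalIntegral.integral_of_le (by linarith)]
  congr 1
  by_cases hR : R = 0
  · simp [hR]; ring
  · rw [intervalIntegral.integral_comp_mul_left _ hR, integral_cos]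
    by_cases hu0 : u = 0
    · simp [hu0]
    · rw [Real.sinc_of_ne_zero (mul_ne_zero hR hu0)]
      simp only [mul_neg, Real.sin_neg, smul_eq_mul]
      field_simp
      ring

lemma sph0_sinc (R : ℝ) (x : V3) : sph0 R x = Real.sinc (R * nrm3 x) := by
  rw [sph0, Real.sinc]

lemma radial_final (h : ℝ → ℂ) (hm : Measurable h) (C : ℝ) (hC : ∀ u, ‖h u‖ ≤ C * ((1 + u ^ 2) ^ 3)⁻¹)
    (hint : Integrable (fun x : V3 => h (nrm3 x))) (R : ℝ) :
    ∫ x : V3, h (nrm3 x) * ((Real.cos (R * x 2) : ℝ) : ℂ) = ∫ x : V3, h (nrm3 x) * (sph0 R x : ℂ) := by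
  have hs : Continuous (fun u : ℝ => ((Real.sinc (R * u) : ℝ) : ℂ)) := by
    have := Real.continuous_sinc
    fun_prop
  have hsb : ∀ u : ℝ, ‖((Real.sinc (R * u) : ℝ) : ℂ)‖ ≤ 1 := fun u => by
    rw [Complex.norm_real]; exact Real.abs_sinc_le_one _
  have hnc : Continuous nrm3 := by unfold nrm3; fun_prop
  rw [cyl h hm C hC hint (fun z => ((Real.cos (R * z) : ℝ) : ℂ)) (by fun_prop)
    (fun z => by rw [Complex.norm_real]; exact Real.abs_cos_le_one _)]
  have h2 := cyl (fun u => h u * ((Real.sinc (R * u) : ℝ) : ℂ)) (hm.mul hs.measurable) C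
    (fun u => by
      rw [norm_mul]
      exact (mul_le_of_le_one_right (norm_nonneg _) (hsb u)).trans (hC u))
    (hint.mul_bdd (c := 1) (hs.comp hnc).aestronglyMeasurable (Filter.Eventually.of_forall fun x => hsb _))
    (fun _ => 1) continuous_const (by simp)
  simp only [mul_one] at h2
  simp_rw [sph0_sinc]
  rw [h2]
  congr 2
  ext u
  rcases le_total 0 u with hu | hu
  · rw [int_cos R u hu]
    have : ∫ z in Set.Ioo (-u) u, (1:ℂ) = 2 * u := by
      simp [hu]; ring
    rw [this]
    push_cast
    ring
  · have : Set.Ioo (-u) u = ∅ := Set.Ioo_eq_empty (by linarith)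
    simp [this]

/-- partial integral in `y` -/
def GG (F : V3 × V3 → ℂ) (x : V3) : ℂ := ∫ y : V3, F (x, y)

lemma GG_inv (F : V3 × V3 → ℂ) (hF : Inv3 F) (k : Mat3) (hk : k ∈ SO3) (x : V3) :
    GG F (k *ᵥ x) = GG F x := by
  unfold GG
  rw [← (rot_mp k hk).integral_comp (rotEquiv k hk).measurableEmbedding]
  refine integral_congr_ae (Filter.Eventually.of_forall fun y => hF k hk x y)

lemma GG_radial (F : V3 × V3 → ℂ) (hF : Inv3 F) (x : V3) :
    GG F x = GG F ![0, 0, nrm3 x] := by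
  obtain ⟨α, h1, h0⟩ := exists_angle (x 1) (x 0)
  set ρ := Real.sqrt (x 1 ^ 2 + x 0 ^ 2) with hρ
  obtain ⟨β, h2, h3⟩ := exists_angle (x 2) ρ
  have hn : Real.sqrt (x 2 ^ 2 + ρ ^ 2) = nrm3 x := by
    rw [hρ, Real.sq_sqrt (by positivity), nrm3]; ring_nf
  rw [hn] at h2 h3
  have hα := Real.sin_sq_add_cos_sq α
  have hβ := Real.sin_sq_add_cos_sq β
  have e1 : rotZ α *ᵥ x = ![0, ρ, x 2] := by
    rw [rotZ_apply]
    congr 1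
    · rw [h0, h1]; ring
    · congr 1
      rw [h0, h1]; linear_combination ρ * hα
  have e2 : rotX β *ᵥ ![0, ρ, x 2] = ![0, 0, nrm3 x] := by
    rw [rotX_apply]
    simp only [Matrix.cons_val]
    congr 2
    · linear_combination Real.cos β * h3 - Real.sin β * h2
    · congr 1
      linear_combination Real.sin β * h3 + Real.cos β * h2 + nrm3 x * hβ
  rw [← GG_inv F hF _ (rotZ_mem α) x, e1, ← GG_inv F hF _ (rotX_mem β), e2]

lemma GG_bound (F : SchwartzMap (V3 × V3) ℂ) :
    ∃ C, ∀ u : ℝ, ‖GG F ![0, 0, u]‖ ≤ C * ((1 + u ^ 2) ^ 3)⁻¹ := by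
  set M := 2 ^ 10 * (Finset.Iic (10, 0)).sup (fun m => SchwartzMap.seminorm ℝ m.1 m.2) F with hM
  have hb : ∀ p, (1 + ‖p‖) ^ 10 * ‖F p‖ ≤ M := by
    intro p
    simpa using SchwartzMap.one_add_le_sup_seminorm_apply (𝕜 := ℝ) (m := (10, 0)) (k := 10) (n := 0) le_rfl le_rfl F p
  have hi : Integrable (fun y : V3 => (1 + ‖y‖) ^ (-(4:ℝ))) :=
    integrable_one_add_norm (by simp; norm_num)
  refine ⟨M * ∫ y : V3, (1 + ‖y‖) ^ (-(4:ℝ)), fun u => ?_⟩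
  have hpt : ∀ y : V3, ‖F (![0, 0, u], y)‖ ≤ (M * ((1 + u ^ 2) ^ 3)⁻¹) * (1 + ‖y‖) ^ (-(4:ℝ)) := by
    intro y
    have h := hb (![0, 0, u], y)
    set p : V3 × V3 := (![0, 0, u], y)
    have hy : ‖y‖ ≤ ‖p‖ := le_max_right _ _
    have hu : |u| ≤ ‖p‖ := by
      refine le_trans ?_ (le_max_left _ _)
      have := norm_le_pi_norm (![0, 0, u] : V3) 2
      simpa using this
    have h6 : (1 + u ^ 2) ^ 3 ≤ (1 + ‖p‖) ^ 6 := by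
      calc (1 + u ^ 2) ^ 3 ≤ ((1 + ‖p‖) ^ 2) ^ 3 := by
            gcongr
            rw [← sq_abs u]
            nlinarith [abs_nonneg u, norm_nonneg p]
        _ = _ := by ring
    have h4 : (1 + ‖y‖) ^ 4 ≤ (1 + ‖p‖) ^ 4 := by gcongr
    have hr : (1 + ‖y‖) ^ (-(4:ℝ)) = ((1 + ‖y‖) ^ 4)⁻¹ := by
      rw [Real.rpow_neg (by positivity)]
      norm_cast
    rw [hr]
    have hmul : ((1 + u ^ 2) ^ 3 * (1 + ‖y‖) ^ 4) * ‖F p‖ ≤ M := by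
      refine le_trans ?_ h
      gcongr
      calc _ ≤ (1 + ‖p‖) ^ 6 * (1 + ‖p‖) ^ 4 := by gcongr
        _ = _ := by ring
    rw [mul_assoc, ← mul_inv, ← div_eq_mul_inv, le_div_iff₀ (by positivity)]
    linarith
  calc ‖GG F ![0, 0, u]‖ ≤ ∫ y : V3, (M * ((1 + u ^ 2) ^ 3)⁻¹) * (1 + ‖y‖) ^ (-(4:ℝ)) :=
        norm_integral_le_of_norm_le (hi.const_mul _) (Filter.Eventually.of_forall hpt)
    _ = _ := by rw [integral_const_mul]; ring

lemma b_step3 (F : SchwartzMap (V3 × V3) ℂ) (hF : Inv3 ⇑F) (R : ℝ) :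
    ∫ q : V3 × V3, F q * ((Real.cos (R * q.1 2) : ℝ) : ℂ) =
      ∫ q : V3 × V3, F q * (sph0 R q.1 : ℂ) := by
  have hs0 : Continuous (sph0 R) := by
    rw [show sph0 R = fun x => Real.sinc (R * nrm3 x) from funext (sph0_sinc R)]
    have := Real.continuous_sinc
    unfold nrm3
    fun_prop
  have i1 := schwartz_bdd_integrable F (fun q => ((Real.cos (R * q.1 2) : ℝ) : ℂ)) (by fun_prop) 1
    (fun q => by rw [Complex.norm_real]; exact Real.abs_cos_le_one _)
  have i2 := schwartz_bdd_integrable F (fun q => ((sph0 R q.1 : ℝ) : ℂ)) (by fun_prop) 1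
    (fun q => by rw [Complex.norm_real, sph0_sinc]; exact Real.abs_sinc_le_one _)
  obtain ⟨C, hC⟩ := GG_bound F
  have hmeas : Measurable (GG F) := by
    have : StronglyMeasurable (fun q : V3 × V3 => F q) := F.continuous.stronglyMeasurable
    exact this.integral_prod_right'.measurable
  have hline : Continuous (fun u : ℝ => (![0, 0, u] : V3)) := by
    refine continuous_pi fun i => ?_
    fin_cases i <;> simp <;> fun_prop
  have key := radial_final (fun u => GG F ![0, 0, u]) (hmeas.comp hline.measurable) C hC
    (by
      simp_rw [← GG_radial F hF]
      exact (schwartz_int F).integral_prod_left) R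
  simp_rw [← GG_radial F hF] at key
  refine (integral_prod _ i1).trans (Eq.trans ?_ (integral_prod _ i2).symm)
  simp_rw [integral_mul_const]
  exact key

lemma part_b (F : SchwartzMap (V3 × V3) ℂ) (hF : Inv3 ⇑F) (zeta r : ℝ) :
      ∫ p : (Fin 3 → ℝ) × ℝ, RadonT ⇑F p.1 p.2 * (sphSing' zeta r p : ℂ)
        = ∫ p : V3 × V3, F p * (sph0 (Real.sqrt (zeta ^ 2 + r ^ 2)) p.1 : ℂ) := by
  rw [← b_step3 F hF, ← b_step2 F hF, ← b_step1 F hF]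
  refine radon_fubini F (fun p => (sphSing' zeta r p : ℂ)) ?_ 1 ?_
  · have := J0_cont
    unfold sphSing'
    fun_prop
  · intro p
    rw [Complex.norm_real, sphSing', norm_mul]
    exact mul_le_one₀ (J0_bdd _) (norm_nonneg _) (Real.abs_cos_le_one _)

/-- The spherical transforms of `F` and of `RF` are intertwined: `𝒢'(RF) = 𝒢F ∘ Π`. -/
theorem statement5 (μ : Measure Mat3) (hμ : IsHaarSO3 μ)
    (F : SchwartzMap (V3 × V3) ℂ) (hF : Inv3 ⇑F) :
    (∀ lam > (0:ℝ), ∀ l : ℕ, ∀ r : ℝ,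
      ∫ p : (Fin 3 → ℝ) × ℝ, RadonT ⇑F p.1 p.2 * (sph' lam l r p : ℂ)
        = ∫ p : V3 × V3, F p * (starRingEnd ℂ) (sph μ lam l r p.1 p.2)) ∧
    (∀ zeta r : ℝ,
      ∫ p : (Fin 3 → ℝ) × ℝ, RadonT ⇑F p.1 p.2 * (sphSing' zeta r p : ℂ)
        = ∫ p : V3 × V3, F p * (sph0 (Real.sqrt (zeta ^ 2 + r ^ 2)) p.1 : ℂ)) := by
  exact ⟨fun lam hl l r => part_a μ hμ F hF lam hl l r, fun zeta r => part_b F hF zeta r⟩
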